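/- arXiv:2405.00569 — 5 statements merged into one kernel-verified Lean document; each statement's English description precedes it below -/
import Mathlib

section
/- Let f : ℝ → ℝ be infinitely differentiable and x ∈ ℝ. Let a, b, c, α, β be real coefficients satisfying 1 + 2α + 2β = a + b + c. Define D(h) = h³·(β f'''(x−2h) + α f'''(x−h) + f'''(x) + α f'''(x+h) + β f'''(x+2h)) − [a(4f(x+h) − 8f(x+h/2) + 8f(x−h/2) − 4f(x−h)) + (b/5)(8f(x+3h/2) − 12f(x+h) + 12f(x−h) − 8f(x−3h/2)) + (c/35)(8f(x+5h/2) − 20f(x+h) + 20f(x−h) − 8f(x−5h/2))]. Then D(h) = O(h⁵) as h → 0, i.e., the TDCCS scheme is second-order accurate. -/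
open Asymptotics

open Finset in
theorem ContDiff.sub_taylor_sum_isBigO {f : ℝ → ℝ} {n : ℕ} (hf : ContDiff ℝ (n + 1 : ℕ) f)
    (x t : ℝ) :
    (fun h : ℝ => f (x + t * h) -
        ∑ k ∈ range (n + 1), iteratedDeriv k f x * (t * h) ^ k / (k.factorial : ℝ))
      =O[nhds (0 : ℝ)] fun h : ℝ => h ^ (n + 1) := by
  have hlim : Filter.Tendsto (fun h : ℝ => x + t * h) (nhds 0) (nhds x) := by
    have : Continuous fun h : ℝ => x + t * h := by fun_prop
    simpa using this.tendsto 0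
  have hpow : (fun h : ℝ => (t * h) ^ (n + 1)) =O[nhds (0 : ℝ)] fun h : ℝ => h ^ (n + 1) := by
    simp only [mul_pow]
    exact isBigO_const_mul_self _ _ _
  have hrem := ((taylor_isLittleO_univ (x₀ := x) hf).isBigO.comp_tendsto hlim)
  simp only [Function.comp_def, add_sub_cancel_left] at hrem
  refine ((hrem.trans hpow).add (hpow.const_mul_left
    (iteratedDeriv (n + 1) f x / ((n + 1).factorial : ℝ)))).congr_left fun h => ?_
  rw [taylor_within_apply, sum_range_succ]
  simp only [iteratedDerivWithin_univ, smul_eq_mul, add_sub_cancel_left]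
  have : ∀ k : ℕ, ((k.factorial : ℝ)⁻¹ * (t * h) ^ k) * iteratedDeriv k f x =
      iteratedDeriv k f x * (t * h) ^ k / (k.factorial : ℝ) := fun k => by ring
  simp only [this]
  ring

/-- Under the stated Taylor-matching order conditions, the TDCCS residual
(multiplied through by `h³`) is `O(h^5)` as `h → 0`; i.e. the scheme is
second-order accurate. -/
theorem tdccs_second_order (f : ℝ → ℝ) (hf : ContDiff ℝ (⊤ : ℕ∞) f) (x : ℝ)
    (a b c α β : ℝ)
    (h1 : 1 + 2 * α + 2 * β = a + b + c) :
    (fun h : ℝ =>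
      h ^ 3 * (β * iteratedDeriv 3 f (x - 2 * h) + α * iteratedDeriv 3 f (x - h)
          + iteratedDeriv 3 f x + α * iteratedDeriv 3 f (x + h)
          + β * iteratedDeriv 3 f (x + 2 * h))
        - (a * (4 * f (x + h) - 8 * f (x + h / 2) + 8 * f (x - h / 2) - 4 * f (x - h))
          + (b / 5) * (8 * f (x + 3 * h / 2) - 12 * f (x + h) + 12 * f (x - h)
              - 8 * f (x - 3 * h / 2))
          + (c / 35) * (8 * f (x + 5 * h / 2) - 20 * f (x + h) + 20 * f (x - h)
              - 8 * f (x - 5 * h / 2))))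
      =O[nhds (0 : ℝ)] fun h : ℝ => h ^ 5 := by
  have hf5 : ContDiff ℝ (4 + 1 : ℕ) f := contDiff_infty.1 hf 5
  have hg : ContDiff ℝ (1 + 1 : ℕ) (iteratedDeriv 3 f) := by
    rw [iteratedDeriv_eq_iterate]
    exact ContDiff.iterate_deriv' 2 3 (contDiff_infty.1 hf 5)
  have hF := hf5.sub_taylor_sum_isBigO x
  have hG (t : ℝ) := (isBigO_refl (fun h : ℝ => h ^ 3) (nhds 0)).mul
    (hg.sub_taylor_sum_isBigO x t)
  simp only [← pow_add, Nat.reduceAdd] at hF hG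
  have hodd (t : ℝ) := (hF t).sub (hF (-t))
  have heven (t : ℝ) := (hG t).add (hG (-t))
  refine ((((heven 2).const_mul_left β).add ((heven 1).const_mul_left α)).sub
    (((((hodd 1).const_mul_left (4 * a - 12 * b / 5 - 20 * c / 35)).add
      ((hodd (1 / 2)).const_mul_left (-8 * a))).add
      ((hodd (3 / 2)).const_mul_left (8 * b / 5))).add
      ((hodd (5 / 2)).const_mul_left (8 * c / 35)))).congr_left fun h => ?_
  obtain rfl : a = 1 + 2 * α + 2 * β - b - c := by linarith
  simp only [Finset.sum_range_succ, Finset.sum_range_zero, Nat.factorial]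
  rw [show x - 2 * h = x + -2 * h by ring, show x - h = x + -1 * h by ring,
    show x + h = x + 1 * h by ring, show x + h / 2 = x + 1 / 2 * h by ring,
    show x - h / 2 = x + -(1 / 2) * h by ring, show x + 3 * h / 2 = x + 3 / 2 * h by ring,
    show x - 3 * h / 2 = x + -(3 / 2) * h by ring, show x + 5 * h / 2 = x + 5 / 2 * h by ring,
    show x - 5 * h / 2 = x + -(5 / 2) * h by ring]
  simp only [iteratedDeriv_zero]
  push_cast
  ring
end

section
/- Let f : ℝ → ℝ be infinitely differentiable and x ∈ ℝ. Let a, b, c, α, β be real coefficients satisfying 1 + 2α + 2β = a + b + c and α + 4β = a/16 + 13b/80 + 29c/80. Define D(h) = h³·(β f'''(x−2h) + α f'''(x−h) + f'''(x) + α f'''(x+h) + β f'''(x+2h)) − [a(4f(x+h) − 8f(x+h/2) + 8f(x−h/2) − 4f(x−h)) + (b/5)(8f(x+3h/2) − 12f(x+h) + 12f(x−h) − 8f(x−3h/2)) + (c/35)(8f(x+5h/2) − 20f(x+h) + 20f(x−h) − 8f(x−5h/2))]. Then D(h) = O(h⁷) as h → 0, i.e., the TDCCS scheme is fourth-order accurate.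 -/
open Asymptotics

/-- Taylor's theorem with Peano remainder along a line, in big-O form. -/
theorem isBigO_sub_taylor_sum {g : ℝ → ℝ} {n : ℕ} (hg : ContDiff ℝ (n + 1 : ℕ) g) (x k : ℝ) :
    (fun h : ℝ => g (x + k * h)
        - ∑ i ∈ Finset.range (n + 1), iteratedDeriv i g x / i.factorial * (k * h) ^ i)
      =O[nhds (0 : ℝ)] fun h : ℝ => h ^ (n + 1) := by
  have hline : Filter.Tendsto (fun h : ℝ => x + k * h) (nhds 0) (nhds x) := by
    have : Continuous fun h : ℝ => x + k * h := by fun_prop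
    simpa using this.tendsto 0
  have hscale (d : ℝ) :
      (fun h : ℝ => d * (k * h) ^ (n + 1)) =O[nhds (0 : ℝ)] fun h : ℝ => h ^ (n + 1) := by
    simp only [mul_pow, ← mul_assoc]
    exact (isBigO_refl _ _).const_mul_left _
  have hrem := ((taylor_isLittleO_univ (x₀ := x) hg).comp_tendsto hline).isBigO.trans
    (by simpa [Function.comp_def] using hscale 1)
  refine (hrem.add (hscale (iteratedDeriv (n + 1) g x / (n + 1).factorial))).congr_left fun h => ?_
  simp only [Function.comp_apply, taylor_within_apply, iteratedDerivWithin_univ,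
    Finset.sum_range_succ _ (n + 1), smul_eq_mul, add_sub_cancel_left]
  have hsum : ∑ i ∈ Finset.range (n + 1), ((i.factorial : ℝ)⁻¹ * (k * h) ^ i) * iteratedDeriv i g x
      = ∑ i ∈ Finset.range (n + 1), iteratedDeriv i g x / i.factorial * (k * h) ^ i :=
    Finset.sum_congr rfl fun i _ => by ring
  rw [hsum]
  ring

/-- Under the stated Taylor-matching order conditions, the TDCCS residual
(multiplied through by `h³`) is `O(h^7)` as `h → 0`; i.e. the scheme is
fourth-order accurate. -/
theorem tdccs_fourth_order (f : ℝ → ℝ) (hf : ContDiff ℝ (⊤ : ℕ∞) f) (x : ℝ)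
    (a b c α β : ℝ)
    (h1 : 1 + 2 * α + 2 * β = a + b + c) (h2 : α + 4 * β = a / 16 + 13 * b / 80 + 29 * c / 80) :
    (fun h : ℝ =>
      h ^ 3 * (β * iteratedDeriv 3 f (x - 2 * h) + α * iteratedDeriv 3 f (x - h)
          + iteratedDeriv 3 f x + α * iteratedDeriv 3 f (x + h)
          + β * iteratedDeriv 3 f (x + 2 * h))
        - (a * (4 * f (x + h) - 8 * f (x + h / 2) + 8 * f (x - h / 2) - 4 * f (x - h))
          + (b / 5) * (8 * f (x + 3 * h / 2) - 12 * f (x + h) + 12 * f (x - h)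
              - 8 * f (x - 3 * h / 2))
          + (c / 35) * (8 * f (x + 5 * h / 2) - 20 * f (x + h) + 20 * f (x - h)
              - 8 * f (x - 5 * h / 2))))
      =O[nhds (0 : ℝ)] fun h : ℝ => h ^ 7 := by
  have hf7 : ContDiff ℝ (6 + 1 : ℕ) f := contDiff_infty.1 hf _
  have hf3 : ContDiff ℝ (3 + 1 : ℕ) (iteratedDeriv 3 f) := by
    rw [iteratedDeriv_eq_iterate]
    exact ContDiff.iterate_deriv' (3 + 1) 3 hf7
  have hR := isBigO_sub_taylor_sum hf7 x
  have hS (k : ℝ) := ((isBigO_refl (fun h : ℝ => h ^ 3) (nhds 0)).mul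
    (isBigO_sub_taylor_sum hf3 x k)).congr_right (g₂ := fun h : ℝ => h ^ 7) fun h => by ring
  have hiter (i : ℕ) : iteratedDeriv i (iteratedDeriv 3 f) = iteratedDeriv (i + 3) f := by
    simp only [iteratedDeriv_eq_iterate, Function.iterate_add_apply]
  have hderivs := (((hS (-2)).add (hS 2)).const_mul_left β).add
    (((hS (-1)).add (hS 1)).const_mul_left α)
  have hvals :=
    ((((hR 1).sub (hR (-1))).const_mul_left (4 * a - 12 * b / 5 - 20 * c / 35)).add
      (((hR (1 / 2)).sub (hR (-1 / 2))).const_mul_left (-8 * a))).add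
    ((((hR (3 / 2)).sub (hR (-3 / 2))).const_mul_left (8 * b / 5)).add
      (((hR (5 / 2)).sub (hR (-5 / 2))).const_mul_left (8 * c / 35)))
  refine (hderivs.sub hvals).congr_left fun h => ?_
  simp only [hiter, Finset.sum_range_succ, Finset.sum_range_zero, Nat.factorial]
  rw [show x - 2 * h = x + -2 * h by ring, show x - h = x + -1 * h by ring,
    show x + h = x + 1 * h by ring, show x + h / 2 = x + 1 / 2 * h by ring,
    show x - h / 2 = x + -1 / 2 * h by ring, show x + 3 * h / 2 = x + 3 / 2 * h by ring,
    show x - 3 * h / 2 = x + -3 / 2 * h by ring, show x + 5 * h / 2 = x + 5 / 2 * h by ring,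
    show x - 5 * h / 2 = x + -5 / 2 * h by ring]
  push_cast
  linear_combination (-(h ^ 3 * iteratedDeriv 3 f x)) * h1 - (h ^ 5 * iteratedDeriv 5 f x) * h2
end

section
/- Let f : ℝ → ℝ be infinitely differentiable and x ∈ ℝ. With the CI-P10 coefficients a = 5/3, b = 5/14, c = 1/126, α = 10/21, β = 5/126, define E(h) = β f(x − 3h/2) + α f(x − h/2) + f(x + h/2) + α f(x + 3h/2) + β f(x + 5h/2) − [(a/2)(f(x+h) + f(x)) + (b/2)(f(x+2h) + f(x−h)) + (c/2)(f(x+3h) + f(x−2h))]. Then E(h) = O(h¹⁰) as h → 0, i.e., the tenth-order pentadiagonal compact interpolation scheme reproduces midpoint values with tenth-order accuracy. -/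
open Asymptotics

/-- A linear combination of translates `f (x + s i * h)` whose moments `∑ i, w i * s i ^ k` vanish
for all `k < n` is `O(h ^ n)` as `h → 0`, for every `f` of class `C^n`. -/
theorem isBigO_sum_translates_of_moments_eq_zero {ι : Type*} [Fintype ι] {f : ℝ → ℝ} {n : ℕ}
    (hf : ContDiff ℝ n f) (x : ℝ) (w s : ι → ℝ) (hw : ∀ k < n, ∑ i, w i * s i ^ k = 0) :
    (fun h : ℝ => ∑ i, w i * f (x + s i * h)) =O[nhds (0 : ℝ)] fun h : ℝ => h ^ n := by
  have remainder (i : ι) :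
      (fun h : ℝ => w i * (f (x + s i * h) - taylorWithinEval f n Set.univ x (x + s i * h)))
        =O[nhds (0 : ℝ)] fun h : ℝ => h ^ n := by
    have hlim : Filter.Tendsto (fun h : ℝ => x + s i * h) (nhds 0) (nhds x) := by
      have : Continuous fun h : ℝ => x + s i * h := by fun_prop
      simpa using this.tendsto 0
    have htaylor := ((taylor_isLittleO_univ hf (x₀ := x)).comp_tendsto hlim).isBigO
    refine (htaylor.trans ?_).const_mul_left (w i)
    simpa [Function.comp_def, mul_pow] using
      (isBigO_refl (fun h : ℝ => h ^ n) (nhds 0)).const_mul_left (s i ^ n)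
  have polynomial (h : ℝ) :
      ∑ i, w i * taylorWithinEval f n Set.univ x (x + s i * h)
        = (∑ i, w i * s i ^ n) * ((n.factorial : ℝ)⁻¹ * iteratedDerivWithin n f Set.univ x)
          * h ^ n := by
    have hterm (i : ι) (k : ℕ) :
        w i * (((k.factorial : ℝ)⁻¹ * (x + s i * h - x) ^ k) • iteratedDerivWithin k f Set.univ x)
          = (w i * s i ^ k) * ((k.factorial : ℝ)⁻¹ * iteratedDerivWithin k f Set.univ x) * h ^ k := by
      rw [add_sub_cancel_left, mul_pow, smul_eq_mul]
      ring
    simp_rw [taylor_within_apply, Finset.mul_sum, hterm]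
    rw [Finset.sum_comm]
    simp_rw [← Finset.sum_mul]
    rw [Finset.sum_range_succ, Finset.sum_eq_zero, zero_add]
    intro k hk
    rw [hw k (Finset.mem_range.mp hk), zero_mul, zero_mul]
  have main := (IsBigO.fun_sum fun i (_ : i ∈ Finset.univ) => remainder i).add
    ((isBigO_refl (fun h : ℝ => h ^ n) (nhds 0)).const_mul_left
      ((∑ i, w i * s i ^ n) * ((n.factorial : ℝ)⁻¹ * iteratedDerivWithin n f Set.univ x)))
  refine main.congr_left fun h => ?_
  rw [← polynomial, ← Finset.sum_add_distrib]
  exact Finset.sum_congr rfl fun i _ => by ring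

/-- With the CI-P10 coefficients `a = 5/3`, `b = 5/14`, `c = 1/126`,
`α = 10/21`, `β = 5/126`, the compact-interpolation residual
`E(h) = β f(x − 3h/2) + α f(x − h/2) + f(x + h/2) + α f(x + 3h/2) + β f(x + 5h/2)
       − [(a/2)(f(x+h) + f(x)) + (b/2)(f(x+2h) + f(x−h)) + (c/2)(f(x+3h) + f(x−2h))]`
is `O(h^10)` as `h → 0`; i.e. the tenth-order pentadiagonal compact interpolation
scheme reproduces midpoint values with tenth-order accuracy. -/
theorem ci_p10_tenth_order (f : ℝ → ℝ) (hf : ContDiff ℝ (⊤ : ℕ∞) f) (x : ℝ)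
    (a b c α β : ℝ)
    (ha : a = 5 / 3) (hb : b = 5 / 14) (hc : c = 1 / 126)
    (hα : α = 10 / 21) (hβ : β = 5 / 126) :
    (fun h : ℝ =>
      β * f (x - 3 * h / 2) + α * f (x - h / 2) + f (x + h / 2)
        + α * f (x + 3 * h / 2) + β * f (x + 5 * h / 2)
        - ((a / 2) * (f (x + h) + f x) + (b / 2) * (f (x + 2 * h) + f (x - h))
          + (c / 2) * (f (x + 3 * h) + f (x - 2 * h))))
      =O[nhds (0 : ℝ)] fun h : ℝ => h ^ 10 := by
  subst ha hb hc hα hβ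
  have key := isBigO_sum_translates_of_moments_eq_zero (n := 10) (contDiff_infty.mp hf 10)
    x ![5 / 126, 10 / 21, 1, 10 / 21, 5 / 126,
      -(5 / 6), -(5 / 6), -(5 / 28), -(5 / 28), -(1 / 252), -(1 / 252)]
    ![-(3 / 2), -(1 / 2), 1 / 2, 3 / 2, 5 / 2, 1, 0, 2, -1, 3, -2]
    (by intro k hk; interval_cases k <;> simp [Fin.sum_univ_succ] <;> norm_num)
  refine key.congr_left fun h => ?_
  simp only [Fin.sum_univ_succ, Fin.sum_univ_zero, Matrix.cons_val_zero, Matrix.cons_val_succ]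
  ring_nf
end

section
/- For every real number α_F, with the eighth-order filter coefficients a₀ = (93 + 70α_F)/128, a₁ = (7 + 18α_F)/16, a₂ = (−7 + 14α_F)/32, a₃ = (1 − 2α_F)/16, a₄ = (−1 + 2α_F)/128, the function g(ω) = a₀ + a₁ cos ω + a₂ cos 2ω + a₃ cos 3ω + a₄ cos 4ω − (1 + 2α_F cos ω) satisfies g(ω) = O(ω⁸) as ω → 0; that is, the transfer function T(ω) of the F-8 filter equals 1 + O(ω⁸) for small wavenumbers, so the filter is eighth-order accurate. -/
open Asymptotics

/-- `1 - cos ω` vanishes to second order at the origin. -/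
theorem one_sub_cos_isBigO_sq :
    (fun ω : ℝ => 1 - Real.cos ω) =O[nhds (0 : ℝ)] fun ω : ℝ => ω ^ 2 := by
  refine IsBigO.of_bound 1 (Filter.Eventually.of_forall fun ω => ?_)
  rw [Real.norm_of_nonneg (sub_nonneg.2 (Real.cos_le_one ω)), Real.norm_of_nonneg (sq_nonneg ω)]
  linarith [Real.one_sub_sq_div_two_le_cos (x := ω), sq_nonneg ω]

/-- For every real `α_F`, with the F-8 filter coefficients
`a₀ = (93 + 70α_F)/128`, `a₁ = (7 + 18α_F)/16`, `a₂ = (−7 + 14α_F)/32`,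
`a₃ = (1 − 2α_F)/16`, `a₄ = (−1 + 2α_F)/128`, the function
`g(ω) = a₀ + a₁ cos ω + a₂ cos 2ω + a₃ cos 3ω + a₄ cos 4ω − (1 + 2α_F cos ω)`
satisfies `g(ω) = O(ω⁸)` as `ω → 0`: the F-8 filter is eighth-order accurate. -/
theorem f8_filter_eighth_order (αF : ℝ)
    (a₀ a₁ a₂ a₃ a₄ : ℝ)
    (h₀ : a₀ = (93 + 70 * αF) / 128) (h₁ : a₁ = (7 + 18 * αF) / 16)
    (h₂ : a₂ = (-7 + 14 * αF) / 32) (h₃ : a₃ = (1 - 2 * αF) / 16)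
    (h₄ : a₄ = (-1 + 2 * αF) / 128) :
    (fun ω : ℝ =>
      a₀ + a₁ * Real.cos ω + a₂ * Real.cos (2 * ω) + a₃ * Real.cos (3 * ω)
        + a₄ * Real.cos (4 * ω) - (1 + 2 * αF * Real.cos ω))
      =O[nhds (0 : ℝ)] fun ω : ℝ => ω ^ 8 := by
  have hfactor : ∀ ω : ℝ,
      a₀ + a₁ * Real.cos ω + a₂ * Real.cos (2 * ω) + a₃ * Real.cos (3 * ω)
        + a₄ * Real.cos (4 * ω) - (1 + 2 * αF * Real.cos ω)
      = (2 * αF - 1) / 16 * (1 - Real.cos ω) ^ 4 := by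
    intro ω
    rw [show 4 * ω = 2 * (2 * ω) by ring, Real.cos_three_mul, Real.cos_two_mul (2 * ω),
      Real.cos_two_mul ω, h₀, h₁, h₂, h₃, h₄]
    ring
  simp only [hfactor]
  simpa only [← pow_mul] using (one_sub_cos_isBigO_sq.pow 4).const_mul_left ((2 * αF - 1) / 16)
end

section
/- With the TDCCS-T8 coefficients a = 58021/14120, b = −109007/28240, c = 1029/28240, α = −1261/3530, β = 0, define N(ω) = 2a(8 sin(ω/2) − 4 sin ω) + (2b/5)(12 sin ω − 8 sin(3ω/2)) + (2c/35)(20 sin ω − 8 sin(5ω/2)) and M(ω) = 1 + 2α cos ω + 2β cos 2ω. Then N(ω) − M(ω)·ω³ = O(ω¹¹) as ω → 0; that is, the modified wavenumber ω'''(ω) = N(ω)/M(ω) of the eighth-order TDCCS scheme satisfies ω'''(ω) = ω³ + O(ω¹¹) for small scaled wavenumbers. -/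
open Asymptotics

lemma exp_mul_I_sub_sum_range_isBigO_pow (n : ℕ) :
    (fun x : ℝ => Complex.exp (x * Complex.I)
      - ∑ i ∈ Finset.range n, (x * Complex.I) ^ i / (i.factorial : ℂ))
      =O[nhds (0 : ℝ)] fun x : ℝ => x ^ n := by
  have hlim : Filter.Tendsto (fun x : ℝ => (x : ℂ) * Complex.I) (nhds 0) (nhds 0) := by
    have hcont : Continuous fun x : ℝ => (x : ℂ) * Complex.I := by fun_prop
    simpa using hcont.tendsto 0
  refine ((Complex.exp_sub_sum_range_isBigO_pow n).comp_tendsto hlim).trans ?_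
  refine IsBigO.of_bound 1 (Filter.Eventually.of_forall fun x => ?_)
  simp

lemma sin_sub_taylor_isBigO_pow_eleven :
    (fun x : ℝ => Real.sin x
      - (x - x ^ 3 / 6 + x ^ 5 / 120 - x ^ 7 / 5040 + x ^ 9 / 362880))
      =O[nhds (0 : ℝ)] fun x : ℝ => x ^ 11 := by
  refine IsBigO.trans (IsBigO.of_bound 1 (Filter.Eventually.of_forall fun x => ?_))
    (exp_mul_I_sub_sum_range_isBigO_pow 11)
  rw [one_mul]
  refine le_trans (le_of_eq ?_) (Complex.abs_im_le_norm _)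
  rw [Real.norm_eq_abs, Complex.sub_im, Complex.exp_ofReal_mul_I_im]
  congr 2
  simp [Finset.sum_range_succ, Nat.factorial, pow_succ, mul_assoc]
  ring

lemma cos_sub_taylor_isBigO_pow_eight :
    (fun x : ℝ => Real.cos x - (1 - x ^ 2 / 2 + x ^ 4 / 24 - x ^ 6 / 720))
      =O[nhds (0 : ℝ)] fun x : ℝ => x ^ 8 := by
  refine IsBigO.trans (IsBigO.of_bound 1 (Filter.Eventually.of_forall fun x => ?_))
    (exp_mul_I_sub_sum_range_isBigO_pow 8)
  rw [one_mul]
  refine le_trans (le_of_eq ?_) (Complex.abs_re_le_norm _)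
  rw [Real.norm_eq_abs, Complex.sub_re, Complex.exp_ofReal_mul_I_re]
  congr 2
  simp [Finset.sum_range_succ, Nat.factorial, pow_succ, mul_assoc]
  ring

lemma sin_mul_sub_taylor_isBigO_pow_eleven (k : ℝ) :
    (fun x : ℝ => Real.sin (k * x) - (k * x - (k * x) ^ 3 / 6 + (k * x) ^ 5 / 120
      - (k * x) ^ 7 / 5040 + (k * x) ^ 9 / 362880))
      =O[nhds (0 : ℝ)] fun x : ℝ => x ^ 11 := by
  have hlim : Filter.Tendsto (fun x : ℝ => k * x) (nhds 0) (nhds 0) := by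
    simpa using (continuous_const_mul k).tendsto 0
  refine (sin_sub_taylor_isBigO_pow_eleven.comp_tendsto hlim).trans ?_
  simpa only [Function.comp_def, mul_pow] using
    (isBigO_refl (fun x : ℝ => x ^ 11) (nhds 0)).const_mul_left (k ^ 11)

/-- With the TDCCS-T8 coefficients `a = 58021/14120`, `b = −109007/28240`,
`c = 1029/28240`, `α = −1261/3530`, `β = 0`, the modified-wavenumber numerator
`N(ω) = 2a(8 sin(ω/2) − 4 sin ω) + (2b/5)(12 sin ω − 8 sin(3ω/2))
        + (2c/35)(20 sin ω − 8 sin(5ω/2))`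
and denominator `M(ω) = 1 + 2α cos ω + 2β cos 2ω` satisfy
`N(ω) − M(ω) ω³ = O(ω¹¹)` as `ω → 0`; i.e. the modified wavenumber of the
eighth-order TDCCS scheme satisfies `ω'''(ω) = ω³ + O(ω¹¹)`. -/
theorem tdccs_t8_modified_wavenumber (a b c α β : ℝ)
    (ha : a = 58021 / 14120) (hb : b = -109007 / 28240) (hc : c = 1029 / 28240)
    (hα : α = -1261 / 3530) (hβ : β = 0) :
    (fun ω : ℝ =>
      (2 * a * (8 * Real.sin (ω / 2) - 4 * Real.sin ω)
        + (2 * b / 5) * (12 * Real.sin ω - 8 * Real.sin (3 * ω / 2))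
        + (2 * c / 35) * (20 * Real.sin ω - 8 * Real.sin (5 * ω / 2)))
        - (1 + 2 * α * Real.cos ω + 2 * β * Real.cos (2 * ω)) * ω ^ 3)
      =O[nhds (0 : ℝ)] fun ω : ℝ => ω ^ 11 := by
  subst ha hb hc hα hβ
  have hcos : (fun x : ℝ => (Real.cos x - (1 - x ^ 2 / 2 + x ^ 4 / 24 - x ^ 6 / 720)) * x ^ 3)
      =O[nhds (0 : ℝ)] fun x : ℝ => x ^ 11 :=
    (cos_sub_taylor_isBigO_pow_eight.mul (isBigO_refl (fun x : ℝ => x ^ 3) (nhds 0))).congr_right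
      fun x => by ring
  have hsum := (((((sin_mul_sub_taylor_isBigO_pow_eleven (1 / 2)).const_mul_left
        (16 * (58021 / 14120))).add
      (sin_sub_taylor_isBigO_pow_eleven.const_mul_left
        (-8 * (58021 / 14120) + 24 / 5 * (-109007 / 28240) + 8 / 7 * (1029 / 28240)))).add
      ((sin_mul_sub_taylor_isBigO_pow_eleven (3 / 2)).const_mul_left
        (-16 / 5 * (-109007 / 28240)))).add
      ((sin_mul_sub_taylor_isBigO_pow_eleven (5 / 2)).const_mul_left
        (-16 / 35 * (1029 / 28240)))).add
      (hcos.const_mul_left (-2 * (-1261 / 3530)))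
  refine hsum.congr_left fun x => ?_
  rw [show x / 2 = 1 / 2 * x by ring, show 3 * x / 2 = 3 / 2 * x by ring,
    show 5 * x / 2 = 5 / 2 * x by ring]
  ring
end
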